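/- Let p, q ≥ 1 with gcd(p, q) = 1 and n = p + q ≥ 2. In ℚ², let O = {(i + 1/2, n − i − 1/2) : 0 ≤ i ≤ n−1}, let X = {(c + 1/2, ((n−1−c+q) mod n) + 1/2) : 0 ≤ c ≤ n−1}, and let x = {(j, n − j) : 1 ≤ j ≤ n−1} ∪ {(0,0)}. Then J(x, X) − J(x, O) − (1/2)·J(X, X) + (1/2)·J(O, O) − (n−1)/2 = (p−1)(q−1)/2. (This is the evaluation of Sarkar's formula τ(K) = J(x − ½(X+O), X−O) − (n−1)/2 on the diagonal grid diagram of the torus knot T_{p,q}, recovering τ(T_{p,q}) = (p−1)(q−1)/2.) -/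

import Mathlib

/-- Sarkar's pairing `J(A, B)`: half the number of pairs `(a, b) ∈ A × B` with `b`
strictly to the upper right or strictly to the lower left of `a`. -/
def sarkarJ (A B : Finset (ℚ × ℚ)) : ℚ :=
  (1 / 2) * ∑ a ∈ A,
    ((B.filter (fun b => (a.1 < b.1 ∧ a.2 < b.2) ∨ (b.1 < a.1 ∧ b.2 < a.2))).card : ℚ)

theorem sarkarJ_image {s t : Finset ℕ} {f g : ℕ → ℚ × ℚ} (hf : Set.InjOn f s)
    (hg : Set.InjOn g t) :
    sarkarJ (s.image f) (t.image g) = (1 / 2) * ((∑ i ∈ s, (t.filter (fun k =>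
      ((f i).1 < (g k).1 ∧ (f i).2 < (g k).2) ∨
        ((g k).1 < (f i).1 ∧ (g k).2 < (f i).2))).card : ℕ) : ℚ) := by
  unfold sarkarJ
  rw [Finset.sum_image hf]
  push_cast
  congr 1
  refine Finset.sum_congr rfl fun i _ => ?_
  rw [Finset.filter_image, Finset.card_image_of_injOn]
  exact hg.mono (Finset.coe_subset.2 (Finset.filter_subset _ _))

theorem sarkarJ_union_left {A A' : Finset (ℚ × ℚ)} (h : Disjoint A A') (B : Finset (ℚ × ℚ)) :
    sarkarJ (A ∪ A') B = sarkarJ A B + sarkarJ A' B := by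
  unfold sarkarJ
  rw [Finset.sum_union h, mul_add]

theorem sarkarJ_zero_image {t : Finset ℕ} {g : ℕ → ℚ × ℚ} (hg : Set.InjOn g t)
    (hpos : ∀ k ∈ t, 0 < (g k).1 ∧ 0 < (g k).2) :
    sarkarJ {((0 : ℚ), (0 : ℚ))} (t.image g) = (t.card : ℚ) / 2 := by
  unfold sarkarJ
  rw [Finset.sum_singleton, Finset.filter_true_of_mem, Finset.card_image_of_injOn hg]
  · ring
  · intro b hb
    obtain ⟨k, hk, rfl⟩ := Finset.mem_image.1 hb
    exact Or.inl (hpos k hk)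

theorem natCast_lt_natCast_add_half (a b : ℕ) : (a : ℚ) < (b : ℚ) + 1 / 2 ↔ a ≤ b := by
  constructor
  · intro h
    by_contra! hab
    have : (b : ℚ) + 1 ≤ a := by exact_mod_cast hab
    linarith
  · intro h
    have : (a : ℚ) ≤ b := by exact_mod_cast h
    linarith

theorem natCast_add_half_lt_natCast (a b : ℕ) : (a : ℚ) + 1 / 2 < (b : ℚ) ↔ a < b := by
  constructor
  · intro h
    by_contra! hab
    have : (b : ℚ) ≤ a := by exact_mod_cast hab
    linarith
  · intro h
    have : (a : ℚ) + 1 ≤ b := by exact_mod_cast h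
    linarith

/-- The height of the row of the `X`-marking in column `c`. -/
theorem torus_row_eq {p q c : ℕ} (hc : c < p + q) :
    (p + q - 1 - c + q) % (p + q) = if c < q then q - 1 - c else p + q - 1 - c + q := by
  split_ifs with h
  · rw [show p + q - 1 - c + q = (q - 1 - c) + (p + q) by omega, Nat.add_mod_right]
    exact Nat.mod_eq_of_lt (by omega)
  · exact Nat.mod_eq_of_lt (by omega)

theorem sum_range_add_ite (p q : ℕ) :
    ∑ c ∈ Finset.range (p + q), (if c < q then p else q) = 2 * (p * q) := by
  rw [add_comm p q, Finset.sum_range_add]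
  rw [Finset.sum_congr rfl (g := fun _ => p) fun c hc => if_pos (Finset.mem_range.1 hc)]
  simp
  ring

/-- Evaluating Sarkar's formula `τ(K) = J(x − ½(X+O), X−O) − (n−1)/2` on the diagonal
grid diagram of size `n = p + q` representing the torus knot `T_{p,q}` yields
`τ(T_{p,q}) = (p−1)(q−1)/2`. -/
theorem sarkar_tau_torus (p q : ℕ) (hp : 1 ≤ p) (hq : 1 ≤ q)
    (hpq : Nat.gcd p q = 1) (hn : 2 ≤ p + q)
    (O X x : Finset (ℚ × ℚ))
    (hO : O = (Finset.range (p + q)).image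
      (fun i : ℕ => ((i : ℚ) + 1 / 2, ((p + q : ℕ) : ℚ) - (i : ℚ) - 1 / 2)))
    (hX : X = (Finset.range (p + q)).image
      (fun c : ℕ => ((c : ℚ) + 1 / 2, (((p + q - 1 - c + q) % (p + q) : ℕ) : ℚ) + 1 / 2)))
    (hx : x = (Finset.Icc 1 (p + q - 1)).image
      (fun j : ℕ => ((j : ℚ), ((p + q : ℕ) : ℚ) - (j : ℚ))) ∪ {((0 : ℚ), (0 : ℚ))}) :
    sarkarJ x X - sarkarJ x O - (1 / 2) * sarkarJ X X + (1 / 2) * sarkarJ O O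
      - (((p + q : ℕ) : ℚ) - 1) / 2 = ((p : ℚ) - 1) * ((q : ℚ) - 1) / 2 := by
  have hXinj : Set.InjOn (fun c : ℕ => ((c : ℚ) + 1 / 2,
      (((p + q - 1 - c + q) % (p + q) : ℕ) : ℚ) + 1 / 2)) (Finset.range (p + q)) := by
    intro a _ b _ h
    simpa using congrArg Prod.fst h
  have hOinj : Set.InjOn (fun i : ℕ => ((i : ℚ) + 1 / 2, ((p + q : ℕ) : ℚ) - (i : ℚ) - 1 / 2))
      (Finset.range (p + q)) := by
    intro a _ b _ h
    simpa using congrArg Prod.fst h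
  have hxinj : Set.InjOn (fun j : ℕ => ((j : ℚ), ((p + q : ℕ) : ℚ) - (j : ℚ)))
      (Finset.Icc 1 (p + q - 1)) := by
    intro a _ b _ h
    simpa using congrArg Prod.fst h
  have hdisj : Disjoint ((Finset.Icc 1 (p + q - 1)).image
      (fun j : ℕ => ((j : ℚ), ((p + q : ℕ) : ℚ) - (j : ℚ)))) {((0 : ℚ), (0 : ℚ))} := by
    rw [Finset.disjoint_singleton_right, Finset.mem_image]
    rintro ⟨j, hj, h⟩
    have h0 : j = 0 := by simpa using congrArg Prod.fst h
    have := (Finset.mem_Icc.1 hj).1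
    omega
  have hOrow : ∀ i < p + q,
      ((p + q : ℕ) : ℚ) - (i : ℚ) - 1 / 2 = ((p + q - 1 - i : ℕ) : ℚ) + 1 / 2 := by
    intro i hi
    have h : ((p + q - 1 - i : ℕ) : ℚ) + i + 1 = ((p + q : ℕ) : ℚ) := by
      exact_mod_cast (by omega : p + q - 1 - i + i + 1 = p + q)
    linarith
  have hxrow : ∀ j ∈ Finset.Icc 1 (p + q - 1),
      ((p + q : ℕ) : ℚ) - (j : ℚ) = ((p + q - j : ℕ) : ℚ) := by
    intro j hj
    rw [Nat.cast_sub]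
    have := Finset.mem_Icc.1 hj
    omega
  have hOO : sarkarJ O O = 0 := by
    rw [hO, sarkarJ_image hOinj hOinj, Finset.sum_eq_zero, Nat.cast_zero, mul_zero]
    intro i _
    rw [Finset.card_eq_zero, Finset.filter_eq_empty_iff]
    rintro k _ (⟨h1, h2⟩ | ⟨h1, h2⟩) <;> dsimp only at h1 h2 <;> linarith
  have hxO : sarkarJ x O = ((p + q : ℕ) : ℚ) / 2 := by
    rw [hx, hO, sarkarJ_union_left hdisj, sarkarJ_image hxinj hOinj, Finset.sum_eq_zero,
      sarkarJ_zero_image hOinj, Finset.card_range]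
    · simp
    · intro k hk
      dsimp only
      rw [hOrow k (Finset.mem_range.1 hk)]
      constructor <;> positivity
    · intro j hj
      rw [Finset.card_eq_zero, Finset.filter_eq_empty_iff]
      intro k hk
      have hk' := Finset.mem_range.1 hk
      have hj' := Finset.mem_Icc.1 hj
      dsimp only
      rw [hOrow k hk', hxrow j hj]
      simp only [natCast_lt_natCast_add_half, natCast_add_half_lt_natCast]
      omega
  have hXX : sarkarJ X X = (p : ℚ) * q := by
    rw [hX, sarkarJ_image hXinj hXinj,
      Finset.sum_congr rfl (g := fun c => if c < q then p else q), sum_range_add_ite]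
    · push_cast
      ring
    · intro c hc
      have hc' := Finset.mem_range.1 hc
      trans (if c < q then Finset.Ico q (p + q) else Finset.range q).card
      · congr 1
        ext d
        simp only [Finset.mem_filter, add_lt_add_iff_right, Nat.cast_lt]
        rw [Finset.mem_range]
        by_cases hd : d < p + q
        · rw [torus_row_eq hc', torus_row_eq hd]
          split_ifs <;> simp <;> omega
        · split_ifs <;> simp <;> omega
      · split_ifs <;> simp
  have hxX : sarkarJ x X = (p : ℚ) * q + ((p + q : ℕ) : ℚ) / 2 := by
    rw [hx, hX, sarkarJ_union_left hdisj, sarkarJ_image hxinj hXinj,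
      sarkarJ_zero_image hXinj, Finset.card_range]
    · congr 1
      simp only [Finset.card_filter]
      rw [Finset.sum_comm]
      simp only [← Finset.card_filter]
      rw [Finset.sum_congr rfl (g := fun c => if c < q then p else q), sum_range_add_ite]
      · push_cast
        ring
      · intro c hc
        have hc' := Finset.mem_range.1 hc
        trans (if c < q then Finset.Icc (c + 1) (c + p) else Finset.Icc (c - q + 1) c).card
        · congr 1
          ext j
          rw [Finset.mem_filter]
          by_cases hj : j ∈ Finset.Icc 1 (p + q - 1)
          · rw [hxrow j hj, torus_row_eq hc']
            simp only [natCast_lt_natCast_add_half, natCast_add_half_lt_natCast]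
            have := Finset.mem_Icc.1 hj
            split_ifs <;> simp <;> omega
          · rw [Finset.mem_Icc] at hj
            split_ifs <;> simp <;> omega
        · split_ifs <;> simp
          omega
    · intro k _
      constructor <;> positivity
  rw [hxX, hxO, hXX, hOO]
  push_cast
  ring
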